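/- Let p be a prime, let 0 ≤ m ≤ p−2, and let r be a natural number with p ∤ C(r, m+1) (binomial coefficient). Let D = X^p∂/∂X + Y^p∂/∂Y and θ = X^p·Y − X·Y^p in 𝔽_p[X,Y]. Then for every homogeneous polynomial Q ∈ 𝔽_p[X,Y] of degree r, θ^{m+1} divides D(Q) if and only if θ^{m+1} divides Q. -/

import Mathlib

open MvPolynomial

/-- Serre's differential operator `D = X^p ∂/∂X + Y^p ∂/∂Y` on `𝔽_p[X,Y]`. -/
noncomputable def Dop (p : ℕ) :
    Module.End (ZMod p) (MvPolynomial (Fin 2) (ZMod p)) :=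
  (LinearMap.mulLeft (ZMod p) ((X 0 : MvPolynomial (Fin 2) (ZMod p)) ^ p)) ∘ₗ
      (pderiv (0 : Fin 2)).toLinearMap +
    (LinearMap.mulLeft (ZMod p) ((X 1 : MvPolynomial (Fin 2) (ZMod p)) ^ p)) ∘ₗ
      (pderiv (1 : Fin 2)).toLinearMap

/-- The Dickson polynomial `θ = X^p·Y − X·Y^p`. -/
noncomputable def theta (p : ℕ) : MvPolynomial (Fin 2) (ZMod p) :=
  X 0 ^ p * X 1 - X 0 * X 1 ^ p

/-- The derivation `a • ∂/∂X + b • ∂/∂Y` of `R[X,Y]`. -/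
noncomputable def planeDerivation {R : Type*} [CommRing R] (a b : MvPolynomial (Fin 2) R) :
    Derivation R (MvPolynomial (Fin 2) R) (MvPolynomial (Fin 2) R) :=
  a • pderiv 0 + b • pderiv 1

theorem planeDerivation_apply {R : Type*} [CommRing R] (a b f : MvPolynomial (Fin 2) R) :
    planeDerivation a b f = a * pderiv 0 f + b * pderiv 1 f := rfl

theorem Dop_apply (p : ℕ) (Q : MvPolynomial (Fin 2) (ZMod p)) :
    Dop p Q = planeDerivation (X 0 ^ p) (X 1 ^ p) Q := rfl

theorem Derivation.apply_pow_mul_of_apply_eq_mul {R A : Type*} [CommRing R] [CommRing A]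
    [Algebra R A] (δ : Derivation R A A) {a c : A} (h : δ a = c * a) (k : ℕ) (b : A) :
    δ (a ^ k * b) = a ^ k * (k * c * b + δ b) := by
  induction k with
  | zero => simp
  | succ k ih =>
    rw [pow_succ', mul_assoc, Derivation.leibniz, ih, h]
    simp only [smul_eq_mul]
    push_cast
    ring

theorem pderiv_zero_theta (p : ℕ) : pderiv 0 (theta p) = -X 1 ^ p := by
  simp [theta, pderiv_X, Derivation.leibniz, Derivation.leibniz_pow]

theorem pderiv_one_theta (p : ℕ) : pderiv 1 (theta p) = X 0 ^ p := by
  simp [theta, pderiv_X, Derivation.leibniz, Derivation.leibniz_pow]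

theorem Dop_theta_pow_mul (p k : ℕ) (R : MvPolynomial (Fin 2) (ZMod p)) :
    Dop p (theta p ^ k * R) = theta p ^ k * Dop p R := by
  have h : planeDerivation (X 0 ^ p) (X 1 ^ p) (theta p) = 0 * theta p := by
    rw [planeDerivation_apply, pderiv_zero_theta, pderiv_one_theta]
    ring
  rw [Dop_apply, Dop_apply, Derivation.apply_pow_mul_of_apply_eq_mul _ h]
  ring

theorem euler_theta_pow_mul (p k : ℕ) (R : MvPolynomial (Fin 2) (ZMod p)) :
    planeDerivation (X 0) (X 1) (theta p ^ k * R) =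
      theta p ^ k * (k * R + planeDerivation (X 0) (X 1) R) := by
  have h : planeDerivation (X 0) (X 1) (theta p) = 1 * theta p := by
    rw [planeDerivation_apply, pderiv_zero_theta, pderiv_one_theta, theta]
    ring
  rw [Derivation.apply_pow_mul_of_apply_eq_mul _ h]
  ring

theorem theta_ne_zero (p : ℕ) [Fact p.Prime] : theta p ≠ 0 := fun h => by
  have := pderiv_one_theta p
  rw [h, map_zero] at this
  exact pow_ne_zero p (X_ne_zero 0) this.symm

theorem isRelPrime_X_pow (p : ℕ) [Fact p.Prime] (n : ℕ) :
    IsRelPrime (X 0 ^ n : MvPolynomial (Fin 2) (ZMod p)) (X 1 ^ n) := by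
  refine IsRelPrime.pow ?_
  refine ((X_prime (i := (0 : Fin 2))).irreducible.isRelPrime_iff_not_dvd).2 ?_
  simp [X_dvd_X]

theorem dvd_of_dvd_mul_of_dvd_mul {A : Type*} [CommRing A] [IsDomain A]
    [DecompositionMonoid A] {t a b c : A} (ht : t ≠ 0) (ha : a ≠ 0) (hab : IsRelPrime a b)
    (h₁ : t ∣ a * c) (h₂ : t ∣ b * c) : t ∣ c := by
  obtain ⟨u, hu⟩ := h₁
  obtain ⟨v, hv⟩ := h₂
  have h : b * u = a * v := mul_left_cancel₀ ht (by linear_combination a * hv - b * hu)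
  obtain ⟨w, rfl⟩ := hab.dvd_of_dvd_mul_left (Dvd.intro v h.symm)
  exact ⟨w, mul_left_cancel₀ ha (by linear_combination hu)⟩

/-- Where the Euler operator acts as an invertible scalar, `θ ∣ D R` forces `θ ∣ R`. -/
theorem theta_dvd_of_dvd_Dop (p : ℕ) [Fact p.Prime] {R : MvPolynomial (Fin 2) (ZMod p)}
    {d : ZMod p} (hd : d ≠ 0) (hR : planeDerivation (X 0) (X 1) R = C d * R)
    (h : theta p ∣ Dop p R) : theta p ∣ R := by
  rw [planeDerivation_apply] at hR
  have hunit : IsUnit (C d : MvPolynomial (Fin 2) (ZMod p)) := (IsUnit.mk0 d hd).map C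
  rw [← hunit.dvd_mul_left]
  refine dvd_of_dvd_mul_of_dvd_mul (theta_ne_zero p) (pow_ne_zero p (X_ne_zero 0))
    (isRelPrime_X_pow p p) ?_ ?_
  · have : X 0 ^ p * (C d * R) = X 0 * Dop p R + theta p * pderiv 1 R := by
      rw [← hR, Dop_apply, planeDerivation_apply, theta]
      ring
    rw [this]
    exact dvd_add (h.mul_left _) (dvd_mul_right _ _)
  · have : X 1 ^ p * (C d * R) = X 1 * Dop p R - theta p * pderiv 0 R := by
      rw [← hR, Dop_apply, planeDerivation_apply, theta]
      ring
    rw [this]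
    exact dvd_sub (h.mul_left _) (dvd_mul_right _ _)

theorem natCast_sub_natCast_ne_zero_of_not_dvd_choose {p r n k : ℕ} [Fact p.Prime]
    (hn : n < p) (hk : k < n) (h : ¬ p ∣ r.choose n) : (r : ZMod p) - k ≠ 0 := by
  intro h0
  have hr : r % p = k := by
    rw [sub_eq_zero, ZMod.natCast_eq_natCast_iff'] at h0
    rw [h0, Nat.mod_eq_of_lt (hk.trans hn)]
  have := Choose.choose_modEq_choose_mod_mul_choose_div_nat (p := p) (n := r) (k := n)
  rw [hr, Nat.mod_eq_of_lt hn, Nat.choose_eq_zero_of_lt hk, zero_mul] at this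
  exact h ((Nat.modEq_zero_iff_dvd).1 this)

/-- if `0 ≤ m ≤ p−2` and `p ∤ C(r, m+1)`, then for every homogeneous `Q` of
degree `r`, `θ^{m+1} ∣ D(Q)` if and only if `θ^{m+1} ∣ Q`. -/
theorem theta_pow_dvd_D_iff (p : ℕ) [Fact p.Prime] (m r : ℕ) (hm : m ≤ p - 2)
    (hchoose : ¬ p ∣ Nat.choose r (m + 1))
    (Q : MvPolynomial (Fin 2) (ZMod p))
    (hQ : Q ∈ homogeneousSubmodule (Fin 2) (ZMod p) r) :
    theta p ^ (m + 1) ∣ Dop p Q ↔ theta p ^ (m + 1) ∣ Q := by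
  have hp := (Fact.out : p.Prime).two_le
  refine ⟨fun h => ?_, ?_⟩
  · have euler : planeDerivation (X 0) (X 1) Q = r * Q := by
      have := ((mem_homogeneousSubmodule r Q).1 hQ).sum_X_mul_pderiv
      rwa [Fin.sum_univ_two, nsmul_eq_mul] at this
    suffices ∀ k ≤ m + 1, theta p ^ k ∣ Q from this _ le_rfl
    intro k
    induction k with
    | zero => simp
    | succ k ih =>
      intro hk
      obtain ⟨R, rfl⟩ := ih (by omega)
      have hθ : theta p ^ k ≠ 0 := pow_ne_zero k (theta_ne_zero p)
      rw [pow_succ]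
      refine mul_dvd_mul_left _ (theta_dvd_of_dvd_Dop p
        (natCast_sub_natCast_ne_zero_of_not_dvd_choose (by omega) hk hchoose) ?_ ?_)
      · rw [euler_theta_pow_mul] at euler
        refine mul_left_cancel₀ hθ ?_
        simp only [map_sub, map_natCast]
        linear_combination euler
      · rw [Dop_theta_pow_mul] at h
        refine (mul_dvd_mul_iff_left hθ).1 ?_
        rw [← pow_succ]
        exact (pow_dvd_pow _ hk).trans h
  · rintro ⟨R, rfl⟩
    rw [Dop_theta_pow_mul]
    exact dvd_mul_right _ _
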